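/- arXiv:2401.15511 — 4 statements merged into one kernel-verified Lean document; each statement's English description precedes it below -/
import Mathlib

section
/- Let μ : ℝⁿ → ℝ be differentiable and Jacobian sign-stable: there is a set S ⊆ {1,…,n} such that ∂μ/∂z_j(z) ≥ 0 for all z whenever j ∈ S, and ∂μ/∂z_j(z) ≤ 0 for all z whenever j ∉ S. Define μ_d : ℝⁿ × ℝⁿ → ℝ by μ_d(z₁, z₂) = μ(w) where w_j = (z₁)_j for j ∈ S and w_j = (z₂)_j for j ∉ S. Then: (i) μ_d(z, z) = μ(z) for all z; (ii) μ_d is monotone nondecreasing in its first argument, i.e., z₁ ≤ z₁′ componentwise implies μ_d(z₁, z₂) ≤ μ_d(z₁′, z₂); and (iii) μ_d is monotone nonincreasing in its second argument, i.e., z₂ ≤ z₂′ componentwise implies μ_d(z₁, z₂′) ≤ μ_d(z₁, z₂). Hence μ_d is a mixed-monotone decomposition function for μ. -/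
/-- A differentiable function does not decrease from `x` to `y` if its derivative in the
direction `y - x` is everywhere nonnegative. -/
theorem le_of_fderiv_sub_nonneg {E : Type*} [NormedAddCommGroup E] [NormedSpace ℝ E]
    {f : E → ℝ} (hf : Differentiable ℝ f) {x y : E} (h : ∀ z, 0 ≤ fderiv ℝ f z (y - x)) :
    f x ≤ f y := by
  have hd (t : ℝ) : HasDerivAt (fun t : ℝ => f (x + t • (y - x)))
      (fderiv ℝ f (x + t • (y - x)) (y - x)) t := by
    have hline : HasDerivAt (fun t : ℝ => x + t • (y - x)) (y - x) t := by
      simpa using ((hasDerivAt_id t).smul_const (y - x)).const_add x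
    exact (hf _).hasFDerivAt.comp_hasDerivAt t hline
  have hmono : Monotone fun t : ℝ => f (x + t • (y - x)) :=
    monotone_of_deriv_nonneg (fun t => (hd t).differentiableAt)
      fun t => by rw [(hd t).deriv]; exact h _
  simpa using hmono zero_le_one

/-- A differentiable function on `ι → ℝ` does not decrease from `x` to `y` if each coordinate of
`y - x` has the same sign as the corresponding partial derivative. -/
theorem le_of_forall_sub_mul_fderiv_single_nonneg {ι : Type*} [Fintype ι] [DecidableEq ι]
    {f : (ι → ℝ) → ℝ} (hf : Differentiable ℝ f) {x y : ι → ℝ}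
    (h : ∀ z j, 0 ≤ (y j - x j) * fderiv ℝ f z (Pi.single j 1)) : f x ≤ f y := by
  refine le_of_fderiv_sub_nonneg hf fun z => ?_
  rw [pi_eq_sum_univ' (y - x), map_sum]
  refine Finset.sum_nonneg fun j _ => ?_
  have hsingle : (fun i => if i = j then (1 : ℝ) else 0) = Pi.single j 1 := by
    ext i
    simp [Pi.single_apply]
  simpa [hsingle] using h z j

/-- The canonical decomposition function of a JSS mapping is a
mixed-monotone decomposition function: it agrees with `μ` on the diagonal,
is nondecreasing in its first argument, and nonincreasing in its second. -/
theorem stmt_4 (n : ℕ) (μ : (Fin n → ℝ) → ℝ)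
    (hμ : Differentiable ℝ μ)
    (S : Finset (Fin n))
    (hpos : ∀ j ∈ S, ∀ z : Fin n → ℝ, 0 ≤ fderiv ℝ μ z (Pi.single j 1))
    (hneg : ∀ j ∉ S, ∀ z : Fin n → ℝ, fderiv ℝ μ z (Pi.single j 1) ≤ 0) :
    let μd : (Fin n → ℝ) → (Fin n → ℝ) → ℝ :=
      fun z1 z2 => μ (fun j => if j ∈ S then z1 j else z2 j)
    (∀ z : Fin n → ℝ, μd z z = μ z) ∧
    (∀ z1 z1' z2 : Fin n → ℝ, z1 ≤ z1' → μd z1 z2 ≤ μd z1' z2) ∧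
    (∀ z1 z2 z2' : Fin n → ℝ, z2 ≤ z2' → μd z1 z2' ≤ μd z1 z2) := by
  intro μd
  refine ⟨fun z => by simp [μd], fun z1 z1' z2 hz => ?_, fun z1 z2 z2' hz => ?_⟩
  · refine le_of_forall_sub_mul_fderiv_single_nonneg hμ fun z j => ?_
    by_cases hj : j ∈ S
    · simpa [hj] using mul_nonneg (sub_nonneg.2 (hz j)) (hpos j hj z)
    · simp [hj]
  · refine le_of_forall_sub_mul_fderiv_single_nonneg hμ fun z j => ?_
    by_cases hj : j ∈ S
    · simp [hj]
    · simpa [hj] using mul_nonneg_of_nonpos_of_nonpos (sub_nonpos.2 (hz j)) (hneg j hj z)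
end

section
/- Let μ : ℝⁿ → ℝ be differentiable and Jacobian sign-stable: there is a set S ⊆ {1,…,n} such that ∂μ/∂z_j(z) ≥ 0 for all z whenever j ∈ S, and ∂μ/∂z_j(z) ≤ 0 for all z whenever j ∉ S. Suppose further that there are vectors J̲, J̄ ∈ ℝⁿ with J̲_j ≤ ∂μ/∂z_j(z) ≤ J̄_j for all z and all j. Define μ_d(z₁, z₂) = μ(w) where w_j = (z₁)_j for j ∈ S and w_j = (z₂)_j for j ∉ S. Then for all z̲ ≤ z̄ in ℝⁿ (componentwise), 0 ≤ μ_d(z̄, z̲) − μ_d(z̲, z̄) ≤ Σ_{j=1}^{n} (max(J̄_j, 0) + max(−J̲_j, 0)) · (z̄_j − z̲_j). -/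
/-- Mean value theorem for a differentiable function of `n` real variables, in coordinates. -/
theorem exists_sub_eq_sum_fderiv_single {ι : Type*} [Fintype ι] [DecidableEq ι]
    {f : (ι → ℝ) → ℝ} (hf : Differentiable ℝ f) (x y : ι → ℝ) :
    ∃ z, f y - f x = ∑ j, fderiv ℝ f z (Pi.single j 1) * (y j - x j) := by
  obtain ⟨z, -, hz⟩ := domain_mvt (s := Set.univ) (f' := fderiv ℝ f)
    (fun w _ => (hf w).hasFDerivAt.hasFDerivWithinAt) convex_univ
    (Set.mem_univ x) (Set.mem_univ y)
  refine ⟨z, hz.trans ?_⟩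
  conv_lhs => rw [pi_eq_sum_univ' (y - x), map_sum]
  refine Finset.sum_congr rfl fun j _ => ?_
  have hj : (fun i => if j = i then (1 : ℝ) else 0) = Pi.single j 1 := by
    ext i
    simp [Pi.single_apply, eq_comm]
  simp [← hj, mul_comm]

/-- Tightness bound for the decomposition function of a JSS mapping:
for `z̲ ≤ z̄`, `0 ≤ μ_d(z̄,z̲) − μ_d(z̲,z̄) ≤ Σⱼ (J̄ⱼ⁺ + (−J̲ⱼ)⁺)(z̄ⱼ − z̲ⱼ)`. -/
theorem stmt_5 (n : ℕ) (μ : (Fin n → ℝ) → ℝ)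
    (hμ : Differentiable ℝ μ)
    (S : Finset (Fin n))
    (hpos : ∀ j ∈ S, ∀ z : Fin n → ℝ, 0 ≤ fderiv ℝ μ z (Pi.single j 1))
    (hneg : ∀ j ∉ S, ∀ z : Fin n → ℝ, fderiv ℝ μ z (Pi.single j 1) ≤ 0)
    (Jl Ju : Fin n → ℝ)
    (hJ : ∀ z : Fin n → ℝ, ∀ j : Fin n,
      Jl j ≤ fderiv ℝ μ z (Pi.single j 1) ∧
      fderiv ℝ μ z (Pi.single j 1) ≤ Ju j) :
    let μd : (Fin n → ℝ) → (Fin n → ℝ) → ℝ :=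
      fun z1 z2 => μ (fun j => if j ∈ S then z1 j else z2 j)
    ∀ zl zu : Fin n → ℝ, zl ≤ zu →
      0 ≤ μd zu zl - μd zl zu ∧
      μd zu zl - μd zl zu ≤
        ∑ j : Fin n, (max (Ju j) 0 + max (-(Jl j)) 0) * (zu j - zl j) := by
  intro μd zl zu hz
  obtain ⟨z, h⟩ := exists_sub_eq_sum_fderiv_single hμ
    (fun j => if j ∈ S then zl j else zu j) (fun j => if j ∈ S then zu j else zl j)
  change 0 ≤ μ _ - μ _ ∧ μ _ - μ _ ≤ _
  rw [h]
  refine ⟨Finset.sum_nonneg fun j _ => ?_, Finset.sum_le_sum fun j _ => ?_⟩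
  · have hd := hz j
    by_cases hj : j ∈ S
    · simpa [hj] using mul_nonneg (hpos j hj z) (sub_nonneg.2 hd)
    · simpa [hj] using mul_nonneg_of_nonpos_of_nonpos (hneg j hj z) (sub_nonpos.2 hd)
  · have hd := sub_nonneg.2 (hz j)
    obtain ⟨hl, hu⟩ := hJ z j
    have hu_max := le_max_left (Ju j) 0
    have hu_nonneg := le_max_right (Ju j) 0
    have hl_max := le_max_left (-Jl j) 0
    have hl_nonneg := le_max_right (-Jl j) 0
    by_cases hj : j ∈ S
    · simp only [hj, if_true]
      exact mul_le_mul_of_nonneg_right (by linarith) hd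
    · simp only [hj, if_false]
      rw [← neg_sub (zu j), mul_neg, ← neg_mul]
      exact mul_le_mul_of_nonneg_right (by linarith) hd
end

section
/- Let A be a real p×n matrix, g : ℝⁿ → ℝᵖ a function, and g_d : ℝⁿ × ℝⁿ → ℝᵖ a mixed-monotone decomposition function for g. Then for all x̲, x, x̄ ∈ ℝⁿ with x̲ ≤ x ≤ x̄ componentwise, A⁺x̲ − A⁻x̄ + g_d(x̲, x̄) ≤ Ax + g(x) ≤ A⁺x̄ − A⁻x̲ + g_d(x̄, x̲) componentwise. (This is the correctness of one local framer propagation step: the computed interval is guaranteed to contain the true value of Ax + g(x).) -/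
/-- Multiplication by an entrywise nonnegative matrix is monotone. -/
theorem mulVec_le_mulVec_of_entries_nonneg {m n : Type*} [Fintype n] {M : Matrix m n ℝ}
    (hM : ∀ i j, 0 ≤ M i j) {x y : n → ℝ} (hxy : x ≤ y) : M.mulVec x ≤ M.mulVec y :=
  fun i => Finset.sum_le_sum fun j _ => mul_le_mul_of_nonneg_left (hxy j) (hM i j)

/-- Correctness of one local framer propagation step: the interval computed
from the matrix bounding rule plus a mixed-monotone decomposition function
contains the true value of `Ax + g(x)`. -/
theorem stmt_7 (p n : ℕ) (A : Matrix (Fin p) (Fin n) ℝ)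
    (g : (Fin n → ℝ) → (Fin p → ℝ))
    (gd : (Fin n → ℝ) → (Fin n → ℝ) → (Fin p → ℝ))
    (hdiag : ∀ x : Fin n → ℝ, gd x x = g x)
    (hmono1 : ∀ x1 x1' x2 : Fin n → ℝ, x1 ≤ x1' → gd x1 x2 ≤ gd x1' x2)
    (hmono2 : ∀ x1 x2 x2' : Fin n → ℝ, x2 ≤ x2' → gd x1 x2' ≤ gd x1 x2)
    (xl x xu : Fin n → ℝ) (h1 : xl ≤ x) (h2 : x ≤ xu) :
    let Ap : Matrix (Fin p) (Fin n) ℝ := fun i j => max (A i j) 0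
    let An : Matrix (Fin p) (Fin n) ℝ := Ap - A
    Ap.mulVec xl - An.mulVec xu + gd xl xu ≤ A.mulVec x + g x ∧
      A.mulVec x + g x ≤ Ap.mulVec xu - An.mulVec xl + gd xu xl := by
  intro Ap An
  have hAp : ∀ i j, 0 ≤ Ap i j := fun i j => le_max_right _ _
  have hAn : ∀ i j, 0 ≤ An i j := fun i j => sub_nonneg.2 (le_max_left _ _)
  have hA : A.mulVec x = Ap.mulVec x - An.mulVec x := by
    rw [← Matrix.sub_mulVec, sub_sub_cancel]
  rw [hA, ← hdiag x]
  exact ⟨add_le_add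
      (sub_le_sub (mulVec_le_mulVec_of_entries_nonneg hAp h1)
        (mulVec_le_mulVec_of_entries_nonneg hAn h2))
      ((hmono1 _ _ _ h1).trans (hmono2 _ _ _ h2)),
    add_le_add
      (sub_le_sub (mulVec_le_mulVec_of_entries_nonneg hAp h2)
        (mulVec_le_mulVec_of_entries_nonneg hAn h1))
      ((hmono1 _ _ _ h2).trans (hmono2 _ _ _ h1))⟩
end

section
/- Let M be a real n×n matrix with all entries nonnegative. Then the following are equivalent: (i) there exists a vector p ∈ ℝⁿ with p_i > 0 for every i such that pᵀM < pᵀ strictly in every component (equivalently, pᵀ(M − I) < 0); (ii) M^k converges to the zero matrix as k → ∞ (i.e., M is Schur stable). -/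
open Filter Topology in
/-- A strict inequality `pᵀM < pᵀ` leaves room for a contraction factor. -/
lemma exists_contraction_factor {ι : Type*} [Fintype ι] {M : Matrix ι ι ℝ} {p : ι → ℝ}
    (h : ∀ j, Matrix.vecMul p M j < p j) :
    ∃ c : ℝ, 0 ≤ c ∧ c < 1 ∧ ∀ j, Matrix.vecMul p M j ≤ c * p j := by
  have hall : ∀ᶠ c : ℝ in 𝓝[<] 1, ∀ j, Matrix.vecMul p M j < c * p j := by
    refine eventually_all.2 fun j => nhdsWithin_le_nhds ?_
    have hcont : Tendsto (fun c : ℝ => c * p j) (𝓝 1) (𝓝 (1 * p j)) :=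
      tendsto_id.mul_const _
    exact hcont.eventually (lt_mem_nhds (by simpa using h j))
  have hpos : ∀ᶠ c : ℝ in 𝓝[<] 1, 0 < c :=
    nhdsWithin_le_nhds (lt_mem_nhds one_pos)
  obtain ⟨c, hc, hc0, hc1⟩ := (hall.and (hpos.and self_mem_nhdsWithin)).exists
  exact ⟨c, hc0.le, hc1, fun j => (hc j).le⟩

lemma Matrix.vecMul_pow_le {ι : Type*} [Fintype ι] [DecidableEq ι] {M : Matrix ι ι ℝ}
    (hM : ∀ i j, 0 ≤ M i j) {p : ι → ℝ} {c : ℝ} (hc : 0 ≤ c)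
    (h : ∀ j, Matrix.vecMul p M j ≤ c * p j) (k : ℕ) (j : ι) :
    Matrix.vecMul p (M ^ k) j ≤ c ^ k * p j := by
  induction k generalizing j with
  | zero => simp
  | succ k ih =>
    calc Matrix.vecMul p (M ^ (k + 1)) j
        = ∑ i, Matrix.vecMul p (M ^ k) i * M i j := by
          rw [pow_succ, ← Matrix.vecMul_vecMul]; rfl
      _ ≤ ∑ i, c ^ k * p i * M i j :=
          Finset.sum_le_sum fun i _ => mul_le_mul_of_nonneg_right (ih i) (hM i j)
      _ = c ^ k * Matrix.vecMul p M j := by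
          simp only [Matrix.vecMul, dotProduct, Finset.mul_sum, mul_assoc]
      _ ≤ c ^ k * (c * p j) := mul_le_mul_of_nonneg_left (h j) (pow_nonneg hc k)
      _ = c ^ (k + 1) * p j := by ring

open Filter Topology in
/-- If `M ^ k → 0`, some power of `M` with positive exponent has all column sums below one. -/
lemma exists_pow_succ_colSum_lt_one {ι : Type*} [Fintype ι] [DecidableEq ι] {M : Matrix ι ι ℝ}
    (h : Tendsto (fun k : ℕ => M ^ k) atTop (𝓝 0)) :
    ∃ N : ℕ, ∀ j, Matrix.vecMul 1 (M ^ (N + 1)) j < 1 := by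
  have hall : ∀ᶠ k in atTop, ∀ j, Matrix.vecMul 1 (M ^ k) j < 1 := by
    refine eventually_all.2 fun j => ?_
    have hcont : Continuous fun A : Matrix ι ι ℝ => Matrix.vecMul 1 A j :=
      (continuous_apply j).comp (continuous_const.matrix_vecMul continuous_id)
    exact ((hcont.tendsto 0).comp h).eventually (gt_mem_nhds (by simp))
  exact ((tendsto_add_atTop_nat 1).eventually hall).exists

/-- For an entrywise nonnegative matrix `M`, the existence of a strictly
positive vector `p` with `pᵀM < pᵀ` (strictly, componentwise) is equivalent
to Schur stability of `M`, i.e. `M^k → 0`. -/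
theorem stmt_13 (n : ℕ) (M : Matrix (Fin n) (Fin n) ℝ)
    (hM : ∀ i j, 0 ≤ M i j) :
    (∃ p : Fin n → ℝ, (∀ i, 0 < p i) ∧ ∀ j, Matrix.vecMul p M j < p j) ↔
      Filter.Tendsto (fun k : ℕ => M ^ k) Filter.atTop (nhds 0) := by
  constructor
  · rintro ⟨p, hp, h⟩
    obtain ⟨c, hc0, hc1, hc⟩ := exists_contraction_factor h
    refine tendsto_pi_nhds.2 fun i => tendsto_pi_nhds.2 fun j => ?_
    have hlim : Filter.Tendsto (fun k : ℕ => c ^ k * (p j / p i)) Filter.atTop (nhds 0) := by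
      simpa using (tendsto_pow_atTop_nhds_zero_of_lt_one hc0 hc1).mul_const (p j / p i)
    refine squeeze_zero (fun k => Matrix.pow_apply_nonneg hM k i j) (fun k => ?_) hlim
    rw [← mul_div_assoc, le_div_iff₀' (hp i)]
    exact (Finset.single_le_sum (f := fun l => p l * (M ^ k) l j)
      (fun l _ => mul_nonneg (hp l).le (Matrix.pow_apply_nonneg hM k l j))
      (Finset.mem_univ i)).trans (Matrix.vecMul_pow_le hM hc0 hc k j)
  · intro h
    obtain ⟨N, hN⟩ := exists_pow_succ_colSum_lt_one h
    refine ⟨Matrix.vecMul 1 (∑ k ∈ Finset.range (N + 1), M ^ k), fun j => ?_, fun j => ?_⟩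
    · rw [Finset.sum_range_succ', pow_zero, Matrix.vecMul_add, Matrix.vecMul_one]
      have hnonneg : 0 ≤ Matrix.vecMul 1 (∑ k ∈ Finset.range N, M ^ (k + 1)) j := by
        simp only [Matrix.vecMul, one_dotProduct]
        refine Finset.sum_nonneg fun i _ => ?_
        rw [Matrix.sum_apply]
        exact Finset.sum_nonneg fun k _ => Matrix.pow_apply_nonneg hM _ i j
      exact add_pos_of_nonneg_of_pos hnonneg one_pos
    · have hgeom := congrArg (fun A => Matrix.vecMul 1 A j) (geom_sum_mul M (N + 1))
      simp only [mul_sub, mul_one, Matrix.vecMul_sub, Matrix.vecMul_one, Pi.sub_apply,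
        Pi.one_apply, ← Matrix.vecMul_vecMul] at hgeom
      linarith [hN j]
end
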